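/- (Two-tails regime, Brownian case of the generator convergence.) Fix d ≥ 1, u₀ > 0, p ∈ [1,∞], and parameters a₁ > 2 and a₂ > 2. For δ ∈ (0,1) define, for four times continuously differentiable φ : ℝ^d → ℝ with max_{|κ|≤4} ‖∂_κ φ‖_p < ∞, L^δ φ(x) := u₀ V₁ δ^{−2} ∫₁^∞ ∫₁^∞ ( φ̄̄(x, δ r₁, δ r₂) − φ(x) ) dr₁ dr₂ / ( r₁^{1+a₁} r₂^{1+a₂} ), and set σ² := (u₀ V₁/(d+2)) ( 1/((a₁−2) a₂) + 1/(a₁ (a₂−2)) ). Then there exist constants C > 0 and θ > 0 such that for all δ ∈ (0,1) and all such φ: ‖ L^δ φ − (σ²/2) Δφ ‖_p ≤ C δ^θ max_{|κ|≤4} ‖∂_κ φ‖_p. -/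

import Mathlib

open MeasureTheory Metric Set
open scoped ENNReal

noncomputable section

/-- Euclidean space `ℝ^d`. -/
abbrev Euc (d : ℕ) : Type := EuclideanSpace ℝ (Fin d)

/-- The ball average `φ̄(x,r) = (1/V_r) ∫_{B(x,r)} φ(y) dy` (with `φ̄(x,0) = φ(x)`). -/
def ballAvg {d : ℕ} (φ : Euc d → ℝ) (r : ℝ) (x : Euc d) : ℝ :=
  if r = 0 then φ x
  else ((volume (Metric.ball x r)).toReal)⁻¹ * ∫ y in Metric.ball x r, φ y

/-- The double ball average `φ̄̄(x,r,s) = (1/(V_r V_s)) ∫_{B(x,r)} ∫_{B(y,s)} φ(z) dz dy`. -/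
def doubleAvg {d : ℕ} (φ : Euc d → ℝ) (r s : ℝ) (x : Euc d) : ℝ :=
  ballAvg (ballAvg φ s) r x

/-- Partial derivative of `ψ` in the `i`-th coordinate direction. -/
def pd {d : ℕ} (i : Fin d) (ψ : Euc d → ℝ) (x : Euc d) : ℝ :=
  fderiv ℝ ψ x (EuclideanSpace.single i 1)

/-- Iterated partial derivative `∂_κ` along a list of coordinate directions. -/
def listD {d : ℕ} : List (Fin d) → (Euc d → ℝ) → Euc d → ℝ
  | [], ψ => ψ
  | i :: l, ψ => pd i (listD l ψ)

/-- The Laplacian `Δφ = ∑ i ∂²φ/∂x_i²`. -/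
def lap {d : ℕ} (φ : Euc d → ℝ) (x : Euc d) : ℝ := ∑ i : Fin d, listD [i, i] φ x

/-- The volume of the unit ball in `ℝ^d`. -/
def V1 (d : ℕ) : ℝ := (volume (Metric.ball (0 : Euc d) 1)).toReal

/-- `max_{|κ| ≤ n} ‖∂_κ φ‖_p`. -/
def maxDle {d : ℕ} (n : ℕ) (φ : Euc d → ℝ) (p : ℝ≥0∞) : ℝ≥0∞ :=
  ⨆ (l : List (Fin d)) (_ : l.length ≤ n), eLpNorm (listD l φ) p volume



lemma mink_unif {E Ω : Type*} [MeasurableSpace E] [MeasurableSpace Ω] (ν : Measure E) [SFinite ν]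
    (μ : Measure Ω) [IsFiniteMeasure μ] (p : ℝ≥0∞) (hp : 1 ≤ p) (f : E × Ω → ℝ≥0∞)
    (hf : Measurable f) (M : ℝ≥0∞)
    (hM : ∀ᵐ ω ∂μ, eLpNorm (fun x => f (x, ω)) p ν ≤ M) :
    eLpNorm (fun x => ∫⁻ ω, f (x, ω) ∂μ) p ν ≤ μ univ * M := by
  rcases eq_or_ne p ∞ with rfl | hpt
  · rw [eLpNorm_exponent_top]
    have h1 : ∀ᵐ ω ∂μ, ∀ᵐ x ∂ν, f (x, ω) ≤ M := by
      filter_upwards [hM] with ω hω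
      rw [eLpNorm_exponent_top] at hω
      filter_upwards [ae_le_eLpNormEssSup (f := fun x => f (x, ω)) (μ := ν)] with x hx
      exact le_trans (by simpa using hx) hω
    have h2 : ∀ᵐ x ∂ν, ∀ᵐ ω ∂μ, f (x, ω) ≤ M := by
      rw [Measure.ae_ae_comm]
      · exact h1
      · exact measurableSet_le hf measurable_const
    refine essSup_le_of_ae_le _ ?_
    filter_upwards [h2] with x hx
    calc ‖∫⁻ ω, f (x, ω) ∂μ‖ₑ = ∫⁻ ω, f (x, ω) ∂μ := by simp
      _ ≤ ∫⁻ ω, M ∂μ := lintegral_mono_ae hx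
      _ = μ univ * M := by simp [mul_comm]
  · have hp0 : p ≠ 0 := (zero_lt_one.trans_le hp).ne'
    have hq : 0 < p.toReal := ENNReal.toReal_pos hp0 hpt
    have hq1 : 1 ≤ p.toReal := by
      have := ENNReal.toReal_mono hpt hp
      simpa using this
    rw [eLpNorm_eq_lintegral_rpow_enorm_toReal hp0 hpt]
    have key : ∀ x, (∫⁻ ω, f (x, ω) ∂μ) ^ p.toReal
        ≤ (∫⁻ ω, f (x, ω) ^ p.toReal ∂μ) * (μ univ) ^ (p.toReal - 1) := by
      intro x
      have h := eLpNorm_le_eLpNorm_mul_rpow_measure_univ (μ := μ) (f := fun ω => f (x, ω)) hp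
        (hf.comp measurable_prodMk_left).aestronglyMeasurable
      rw [eLpNorm_one_eq_lintegral_enorm, eLpNorm_eq_lintegral_rpow_enorm_toReal hp0 hpt] at h
      have h' := ENNReal.rpow_le_rpow h hq.le
      rw [ENNReal.mul_rpow_of_nonneg _ _ hq.le, ← ENNReal.rpow_mul, ← ENNReal.rpow_mul,
        one_div_mul_cancel hq.ne', ENNReal.rpow_one] at h'
      have e : (1 / (1:ℝ≥0∞).toReal - 1 / p.toReal) * p.toReal = p.toReal - 1 := by
        simp; field_simp
      rw [e] at h'
      simpa using h'
    have h3 : ∫⁻ x, ‖∫⁻ ω, f (x, ω) ∂μ‖ₑ ^ p.toReal ∂ν ≤ (μ univ * M) ^ p.toReal := by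
      calc ∫⁻ x, ‖∫⁻ ω, f (x, ω) ∂μ‖ₑ ^ p.toReal ∂ν
          ≤ ∫⁻ x, (∫⁻ ω, f (x, ω) ^ p.toReal ∂μ) * (μ univ) ^ (p.toReal - 1) ∂ν :=
            lintegral_mono fun x => by simpa using key x
        _ = (∫⁻ x, (∫⁻ ω, f (x, ω) ^ p.toReal ∂μ) ∂ν) * (μ univ) ^ (p.toReal - 1) := by
            rw [lintegral_mul_const]
            exact Measurable.lintegral_prod_right' (f := fun z => f z ^ p.toReal) (by fun_prop)
        _ = (∫⁻ ω, (∫⁻ x, f (x, ω) ^ p.toReal ∂ν) ∂μ) * (μ univ) ^ (p.toReal - 1) := by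
            rw [lintegral_lintegral_swap]
            exact Measurable.aemeasurable (f := fun z => f z ^ p.toReal) (by fun_prop)
        _ ≤ (∫⁻ ω, M ^ p.toReal ∂μ) * (μ univ) ^ (p.toReal - 1) := by
            gcongr ?_ * _
            refine lintegral_mono_ae ?_
            filter_upwards [hM] with ω hω
            rw [eLpNorm_eq_lintegral_rpow_enorm_toReal hp0 hpt] at hω
            have := ENNReal.rpow_le_rpow hω hq.le
            rw [← ENNReal.rpow_mul, one_div_mul_cancel hq.ne', ENNReal.rpow_one] at this
            simpa using this
        _ = (μ univ * M) ^ p.toReal := by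
            rw [lintegral_const, ENNReal.mul_rpow_of_nonneg _ _ hq.le, mul_assoc, mul_comm]
            congr 1
            nth_rewrite 1 [← ENNReal.rpow_one (μ univ)]
            rw [← ENNReal.rpow_add_of_nonneg _ _ zero_le_one (by linarith)]
            congr 1; ring
    have := ENNReal.rpow_le_rpow h3 (z := 1 / p.toReal) (by positivity)
    rwa [← ENNReal.rpow_mul, mul_one_div_cancel hq.ne', ENNReal.rpow_one] at this

lemma mink_weight {E Ω : Type*} [MeasurableSpace E] [MeasurableSpace Ω] (ν : Measure E) [SFinite ν]
    (μ : Measure Ω) [SFinite μ] (p : ℝ≥0∞) (hp : 1 ≤ p) (f : E × Ω → ℝ≥0∞)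
    (hf : Measurable f) (M : ℝ≥0∞) (w : Ω → ℝ≥0∞) (hw : Measurable w)
    (hw0 : ∀ᵐ ω ∂μ, w ω ≠ 0) (hwt : ∫⁻ ω, w ω ∂μ ≠ ∞)
    (hM : ∀ᵐ ω ∂μ, eLpNorm (fun x => f (x, ω)) p ν ≤ w ω * M) :
    eLpNorm (fun x => ∫⁻ ω, f (x, ω) ∂μ) p ν ≤ (∫⁻ ω, w ω ∂μ) * M := by
  have hwt' : ∀ᵐ ω ∂μ, w ω < ∞ := ae_lt_top hw hwt
  have hfin : IsFiniteMeasure (μ.withDensity w) := isFiniteMeasure_withDensity hwt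
  have h := mink_unif ν (μ.withDensity w) p hp (fun z => (w z.2)⁻¹ * f z)
    ((hw.comp measurable_snd).inv.mul hf) M (by
      refine (withDensity_absolutelyContinuous μ w).ae_le ?_
      filter_upwards [hM, hw0, hwt'] with ω h1 h2 h3
      have : (fun x => (w ω)⁻¹ * f (x, ω)) = ((w ω)⁻¹.toNNReal) • (fun x => f (x, ω)) := by
        ext x
        simp only [Pi.smul_apply, ENNReal.smul_def, smul_eq_mul]
        rw [ENNReal.coe_toNNReal (by simpa using h2)]
      have e2 : eLpNorm (fun x => (w ω)⁻¹ * f (x, ω)) p ν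
          ≤ (w ω)⁻¹ * eLpNorm (fun x => f (x, ω)) p ν := by
        rw [this]
        refine (eLpNorm_le_nnreal_smul_eLpNorm_of_ae_le_mul' (c := (w ω)⁻¹.toNNReal) (g := fun x => f (x, ω)) (f := (w ω)⁻¹.toNNReal • (fun x => f (x, ω)))
          (Filter.Eventually.of_forall fun x => ?_) p).trans ?_
        · simp [ENNReal.smul_def]
        · rw [ENNReal.smul_def, smul_eq_mul, ENNReal.coe_toNNReal (by simpa using h2)]
      calc _ ≤ _ := e2
        _ ≤ (w ω)⁻¹ * (w ω * M) := by gcongr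
        _ = M := by rw [← mul_assoc, ENNReal.inv_mul_cancel h2 h3.ne, one_mul])
  rw [withDensity_apply _ MeasurableSet.univ, Measure.restrict_univ] at h
  refine le_trans (le_of_eq ?_) h
  congr 1
  ext x
  rw [lintegral_withDensity_eq_lintegral_mul _ hw
    (by exact (hw.inv).mul (hf.comp measurable_prodMk_left))]
  refine lintegral_congr_ae ?_
  filter_upwards [hw0, hwt'] with ω h2 h3
  simp only [Pi.mul_apply]
  rw [← mul_assoc, ENNReal.mul_inv_cancel h2 h3.ne, one_mul]

section Helpers

variable {d : ℕ}

lemma contDiff_pd {n : ℕ} {ψ : Euc d → ℝ} (h : ContDiff ℝ (n + 1 : ℕ) ψ) (i : Fin d) :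
    ContDiff ℝ n (pd i ψ) := by
  unfold pd
  exact (h.fderiv_right (m := n) (by norm_cast)).clm_apply contDiff_const

lemma hasDerivAt_line {ψ : Euc d → ℝ} (h : Differentiable ℝ ψ) (x v : Euc d) (t : ℝ) :
    HasDerivAt (fun t : ℝ => ψ (x + t • v)) (∑ i, v i * pd i ψ (x + t • v)) t := by
  have h1 : HasDerivAt (fun t : ℝ => x + t • v) v t := by
    simpa using ((hasDerivAt_id t).smul_const v).const_add x
  have h2 := (h (x + t • v)).hasFDerivAt.comp_hasDerivAt t h1
  refine HasDerivAt.congr_deriv (f' := (fderiv ℝ ψ (x + t • v)) v) h2 ?_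
  have hv : v = ∑ i, v i • (EuclideanSpace.single i 1 : Euc d) := by
    have := (EuclideanSpace.basisFun (Fin d) ℝ).sum_repr v
    simpa using this.symm
  unfold pd
  generalize fderiv ℝ ψ (x + t • v) = A
  conv_lhs => rw [hv]
  simp [map_sum]

lemma eLpNorm_shift {ψ : Euc d → ℝ} (h : Continuous ψ) (p : ℝ≥0∞) (v : Euc d) :
    eLpNorm (fun x => ψ (x + v)) p volume = eLpNorm ψ p volume :=
  eLpNorm_comp_measurePreserving h.aestronglyMeasurable (measurePreserving_add_right volume v)

lemma enorm_int01 (g : ℝ → ℝ) : ‖∫ t in (0:ℝ)..1, g t‖ₑ ≤ ∫⁻ t in Ioc (0:ℝ) 1, ‖g t‖ₑ := by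
  rw [intervalIntegral.integral_of_le zero_le_one]
  exact enorm_integral_le_lintegral_enorm _

lemma eLpNorm_int01 (p : ℝ≥0∞) (hp : 1 ≤ p) (G : Euc d → ℝ → ℝ)
    (hG : Continuous (Function.uncurry G)) (M : ℝ≥0∞)
    (hM : ∀ t ∈ Ioc (0:ℝ) 1, eLpNorm (fun x => G x t) p volume ≤ M) :
    eLpNorm (fun x => ∫ t in (0:ℝ)..1, G x t) p volume ≤ M := by
  have h := mink_unif (volume : Measure (Euc d)) (volume.restrict (Ioc (0:ℝ) 1)) p hp
    (fun z => ‖G z.1 z.2‖ₑ) (hG.measurable.enorm) M (by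
      filter_upwards [ae_restrict_mem measurableSet_Ioc] with t ht
      simpa using hM t ht)
  simp only [Measure.restrict_apply_univ, Real.volume_Ioc, sub_zero, ENNReal.ofReal_one,
    one_mul] at h
  refine le_trans (eLpNorm_mono_enorm fun x => ?_) h
  simpa using enorm_int01 (G x)

lemma abs_coord_le (v : Euc d) (i : Fin d) : |v i| ≤ ‖v‖ := by
  simpa using PiLp.norm_apply_le v i

lemma eLpNorm_diff {ψ : Euc d → ℝ} (h : ContDiff ℝ 1 ψ) (p : ℝ≥0∞) (hp : 1 ≤ p) (M : ℝ≥0∞)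
    (hM : ∀ i, eLpNorm (pd i ψ) p volume ≤ M) (v : Euc d) :
    eLpNorm (fun x => ψ (x + v) - ψ x) p volume ≤ ENNReal.ofReal (d * ‖v‖) * M := by
  have hc : ∀ i, Continuous (pd i ψ) := fun i =>
    (contDiff_pd (n := 0) (by simpa using h) i).continuous
  have e : (fun x => ψ (x + v) - ψ x)
      = fun x => ∫ t in (0:ℝ)..1, ∑ i, v i * pd i ψ (x + t • v) := by
    ext x
    rw [intervalIntegral.integral_eq_sub_of_hasDerivAt
      (fun t _ => hasDerivAt_line (h.differentiable (by simp)) x v t)]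
    · simp
    · apply Continuous.intervalIntegrable
      fun_prop
  rw [e]
  refine eLpNorm_int01 p hp _ (by unfold Function.uncurry; fun_prop) _ fun t _ => ?_
  have : (fun x => ∑ i, v i * pd i ψ (x + t • v))
    = ∑ i, fun x => v i * pd i ψ (x + t • v) := by ext x; simp
  rw [this]
  refine (eLpNorm_sum_le (fun i _ => Continuous.aestronglyMeasurable (by fun_prop)) hp).trans ?_
  calc ∑ i, eLpNorm (fun x => v i * pd i ψ (x + t • v)) p volume
      ≤ ∑ i : Fin d, ENNReal.ofReal ‖v‖ * M := by
        refine Finset.sum_le_sum fun i _ => ?_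
        have := eLpNorm_const_smul (v i) (fun x => pd i ψ (x + t • v)) p (volume : Measure (Euc d))
        simp only [smul_eq_mul, Pi.smul_def] at this
        rw [this, eLpNorm_shift (hc i)]
        gcongr
        · rw [Real.enorm_eq_ofReal_abs]
          exact ENNReal.ofReal_le_ofReal (abs_coord_le v i)
        · exact hM i
    _ = ENNReal.ofReal (d * ‖v‖) * M := by
        rw [Finset.sum_const, Finset.card_univ, Fintype.card_fin, nsmul_eq_mul,
          ENNReal.ofReal_mul (by positivity), ENNReal.ofReal_natCast, mul_assoc]

/-- second order Taylor remainder -/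
def tay (φ : Euc d → ℝ) (x v : Euc d) : ℝ :=
  φ (x + v) - φ x - ∑ i, v i * listD [i] φ x
    - (1 / 2) * ∑ i, ∑ j, v i * v j * listD [j, i] φ x

lemma contDiff_listD1 {φ : Euc d → ℝ} (h : ContDiff ℝ 4 φ) (i : Fin d) :
    ContDiff ℝ 3 (listD [i] φ) := contDiff_pd (n := 3) h i

lemma contDiff_listD2 {φ : Euc d → ℝ} (h : ContDiff ℝ 4 φ) (i j : Fin d) :
    ContDiff ℝ 2 (listD [j, i] φ) := contDiff_pd (n := 2) (contDiff_listD1 h i) j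

lemma tay_eq {φ : Euc d → ℝ} (h : ContDiff ℝ 4 φ) (x v : Euc d) :
    tay φ x v = ∫ t in (0:ℝ)..1, (1 - t) *
      ∑ i, ∑ j, v i * v j * (listD [j, i] φ (x + t • v) - listD [j, i] φ x) := by
  have hc2 : ∀ i j, Continuous (listD [j, i] φ) := fun i j => (contDiff_listD2 h i j).continuous
  have hd : ∀ t : ℝ, HasDerivAt (fun t : ℝ => φ (x + t • v)
      + (1 - t) * (∑ i, v i * listD [i] φ (x + t • v))
      - (t - t ^ 2 / 2) * ∑ i, ∑ j, v i * v j * listD [j, i] φ x)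
      ((1 - t) * ∑ i, ∑ j, v i * v j * (listD [j, i] φ (x + t • v) - listD [j, i] φ x)) t := by
    intro t
    have h1 := hasDerivAt_line (h.differentiable (by simp)) x v t
    have h2 : HasDerivAt (fun t : ℝ => ∑ i, v i * listD [i] φ (x + t • v))
        (∑ i, v i * ∑ j, v j * listD [j, i] φ (x + t • v)) t := by
      refine HasDerivAt.fun_sum fun i _ => HasDerivAt.const_mul _ ?_
      exact hasDerivAt_line ((contDiff_listD1 h i).differentiable (by simp)) x v t
    have h3 : HasDerivAt (fun t : ℝ => 1 - t) (-1) t := by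
      simpa using (hasDerivAt_id t).const_sub 1
    have h4 : HasDerivAt (fun t : ℝ => t - t ^ 2 / 2) (1 - t) t := by
      have := (hasDerivAt_id t).sub (((hasDerivAt_id t).pow 2).div_const 2)
      exact HasDerivAt.congr_deriv this (by simp)
    have h5 := (h1.add (h3.mul h2)).sub
      (h4.mul_const (∑ i, ∑ j, v i * v j * listD [j, i] φ x))
    refine HasDerivAt.congr_deriv h5 ?_
    have eA : ∑ i, v i * ∑ j, v j * listD [j, i] φ (x + t • v)
        = ∑ i, ∑ j, v i * v j * listD [j, i] φ (x + t • v) := by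
      simp only [Finset.mul_sum, mul_assoc]
    have eB : ∑ i, ∑ j, v i * v j * (listD [j, i] φ (x + t • v) - listD [j, i] φ x)
        = ∑ i, ∑ j, v i * v j * listD [j, i] φ (x + t • v)
          - ∑ i, ∑ j, v i * v j * listD [j, i] φ x := by
      simp only [mul_sub, Finset.sum_sub_distrib]
    have eC : ∑ i, v i * pd i φ (x + t • v) = ∑ i, v i * listD [i] φ (x + t • v) := rfl
    rw [eA, eB, eC]
    ring
  rw [intervalIntegral.integral_eq_sub_of_hasDerivAt (fun t _ => hd t)]
  · simp [tay]; ring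
  · apply Continuous.intervalIntegrable
    fun_prop

lemma eLpNorm_tay {φ : Euc d → ℝ} (h : ContDiff ℝ 4 φ) (p : ℝ≥0∞) (hp : 1 ≤ p) (v : Euc d)
    (θ : ℝ) (hθ0 : 0 < θ) (hθ1 : θ ≤ 1) :
    eLpNorm (fun x => tay φ x v) p volume
      ≤ ENNReal.ofReal (2 * d ^ 3 * (‖v‖ ^ 2 * ‖v‖ ^ θ)) * maxDle 4 φ p := by
  have hM : ∀ l : List (Fin d), l.length ≤ 4 → eLpNorm (listD l φ) p volume ≤ maxDle 4 φ p :=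
    fun l hl => le_iSup₂_of_le l hl le_rfl
  have hc2 : ∀ i j, Continuous (listD [j, i] φ) := fun i j => (contDiff_listD2 h i j).continuous
  have key : ∀ i j, ∀ t ∈ Ioc (0:ℝ) 1,
      eLpNorm (fun x => listD [j, i] φ (x + t • v) - listD [j, i] φ x) p volume
        ≤ ENNReal.ofReal (2 * d * ‖v‖ ^ θ) * maxDle 4 φ p := by
    intro i j t ht
    have hd1 : (1:ℝ) ≤ d := by
      have : 0 < d := i.pos
      exact_mod_cast this
    rcases le_total 1 ‖v‖ with hv | hv
    · refine (eLpNorm_sub_le (Continuous.aestronglyMeasurable (by fun_prop))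
        (Continuous.aestronglyMeasurable (by fun_prop)) hp).trans ?_
      rw [eLpNorm_shift (hc2 i j)]
      calc _ ≤ maxDle 4 φ p + maxDle 4 φ p := by gcongr <;> exact hM _ (by simp)
        _ = ENNReal.ofReal 2 * maxDle 4 φ p := by
            rw [show ENNReal.ofReal 2 = 2 by simp, two_mul]
        _ ≤ _ := by
            gcongr
            nlinarith [Real.one_le_rpow hv hθ0.le]
    · refine (eLpNorm_diff ((contDiff_listD2 h i j).of_le (by norm_num)) p hp (maxDle 4 φ p)
        (fun k => hM (k :: [j, i]) (by simp)) (t • v)).trans ?_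
      gcongr ENNReal.ofReal ?_ * _
      have h1 : ‖t • v‖ ≤ ‖v‖ := by
        rw [norm_smul, Real.norm_of_nonneg ht.1.le]
        nlinarith [norm_nonneg v, ht.2]
      have h2 : ‖v‖ ≤ ‖v‖ ^ θ := by
        rcases (norm_nonneg v).eq_or_lt with h0 | h0
        · rw [← h0]; positivity
        · simpa using Real.rpow_le_rpow_of_exponent_ge h0 hv hθ1
      nlinarith [norm_nonneg v]
  have e : (fun x => tay φ x v) = fun x => ∫ t in (0:ℝ)..1, (1 - t) *
      ∑ i, ∑ j, v i * v j * (listD [j, i] φ (x + t • v) - listD [j, i] φ x) := by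
    ext x; exact tay_eq h x v
  rw [e]
  refine eLpNorm_int01 p hp _ (by unfold Function.uncurry; fun_prop) _ fun t ht => ?_
  have e2 : (fun x => (1 - t) *
      ∑ i, ∑ j, v i * v j * (listD [j, i] φ (x + t • v) - listD [j, i] φ x))
    = ∑ i, ∑ j, fun x => ((1 - t) * (v i * v j)) * 
        (listD [j, i] φ (x + t • v) - listD [j, i] φ x) := by
    ext x; simp [Finset.mul_sum, mul_assoc]
  rw [e2]
  have hb : ∀ i j, eLpNorm (fun x => ((1 - t) * (v i * v j)) * 
        (listD [j, i] φ (x + t • v) - listD [j, i] φ x)) p volume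
        ≤ ENNReal.ofReal (‖v‖ ^ 2) * (ENNReal.ofReal (2 * d * ‖v‖ ^ θ) * maxDle 4 φ p) := by
    intro i j
    have := eLpNorm_const_smul ((1 - t) * (v i * v j))
      (fun x => listD [j, i] φ (x + t • v) - listD [j, i] φ x) p (volume : Measure (Euc d))
    simp only [smul_eq_mul, Pi.smul_def] at this
    rw [this]
    gcongr
    · rw [Real.enorm_eq_ofReal_abs]
      refine ENNReal.ofReal_le_ofReal ?_
      rw [abs_mul, abs_mul, abs_of_nonneg (by linarith [ht.2])]
      have h1 := mul_le_mul (abs_coord_le v i) (abs_coord_le v j) (abs_nonneg _) (norm_nonneg _)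
      have h2 : 0 ≤ |v i| * |v j| := by positivity
      nlinarith [ht.1, ht.2]
    · exact key i j t ht
  calc _ ≤ ∑ i, ∑ j, eLpNorm (fun x => ((1 - t) * (v i * v j)) * 
        (listD [j, i] φ (x + t • v) - listD [j, i] φ x)) p volume := by
        refine (eLpNorm_sum_le (fun i _ => ?_) hp).trans (Finset.sum_le_sum fun i _ => 
          eLpNorm_sum_le (fun j _ => Continuous.aestronglyMeasurable (by fun_prop)) hp)
        refine Finset.aestronglyMeasurable_sum _ fun j _ => 
          Continuous.aestronglyMeasurable (by fun_prop)
    _ ≤ ∑ i : Fin d, ∑ j : Fin d, ENNReal.ofReal (‖v‖ ^ 2) *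
          (ENNReal.ofReal (2 * d * ‖v‖ ^ θ) * maxDle 4 φ p) :=
        Finset.sum_le_sum fun i _ => Finset.sum_le_sum fun j _ => hb i j
    _ = _ := by
        simp only [Finset.sum_const, Finset.card_univ, Fintype.card_fin, nsmul_eq_mul]
        rw [← ENNReal.ofReal_natCast, ← mul_assoc, ← mul_assoc, ← mul_assoc,
          ← ENNReal.ofReal_mul (by positivity), ← ENNReal.ofReal_mul (by positivity),
          ← ENNReal.ofReal_mul (by positivity)]
        congr 2
        ring

/-- uniform probability on the unit ball -/
def unif (d : ℕ) : Measure (Euc d) := ProbabilityTheory.cond volume (ball 0 1)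

lemma vol_ball_ne_zero : (volume (ball (0 : Euc d) 1)) ≠ 0 :=
  (measure_ball_pos volume _ zero_lt_one).ne'

instance : IsProbabilityMeasure (unif d) :=
  ProbabilityTheory.cond_isProbabilityMeasure_of_finite vol_ball_ne_zero measure_ball_lt_top.ne

lemma unif_ae : ∀ᵐ u ∂(unif d), u ∈ ball (0 : Euc d) 1 :=
  ProbabilityTheory.ae_cond_mem measurableSet_ball

lemma unif2_ae : ∀ᵐ z ∂((unif d).prod (unif d)), 
    z ∈ closedBall (0 : Euc d) 1 ×ˢ closedBall (0 : Euc d) 1 := by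
  have h1 := (Measure.quasiMeasurePreserving_fst (μ := unif d) (ν := unif d)).ae unif_ae
  have h2 := (Measure.quasiMeasurePreserving_snd (μ := unif d) (ν := unif d)).ae unif_ae
  filter_upwards [h1, h2] with z hz1 hz2
  exact ⟨ball_subset_closedBall hz1, ball_subset_closedBall hz2⟩

lemma integrable_unif {F : Euc d → ℝ} (hF : Continuous F) : Integrable F (unif d) := by
  obtain ⟨C, hC⟩ := (isCompact_closedBall (0 : Euc d) 1).exists_bound_of_continuousOn
    hF.continuousOn
  refine Integrable.of_bound hF.aestronglyMeasurable C ?_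
  filter_upwards [unif_ae] with u hu
  exact hC u (ball_subset_closedBall hu)

lemma integrable_unif2 {F : Euc d × Euc d → ℝ} (hF : Continuous F) :
    Integrable F ((unif d).prod (unif d)) := by
  obtain ⟨C, hC⟩ := ((isCompact_closedBall (0 : Euc d) 1).prod
    (isCompact_closedBall (0 : Euc d) 1)).exists_bound_of_continuousOn hF.continuousOn
  refine Integrable.of_bound hF.aestronglyMeasurable C ?_
  filter_upwards [unif2_ae] with u hu
  exact hC u hu

lemma integral_unif (F : Euc d → ℝ) :
    ∫ u, F u ∂(unif d) = (volume (ball (0 : Euc d) 1)).toReal⁻¹ * ∫ u in ball 0 1, F u := by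
  unfold unif ProbabilityTheory.cond
  rw [integral_smul_measure, ENNReal.toReal_inv, smul_eq_mul]

lemma ballAvg_eq (φ : Euc d → ℝ) {r : ℝ} (hr : 0 < r) (x : Euc d) :
    ballAvg φ r x = ∫ u, φ (x + r • u) ∂(unif d) := by
  rw [ballAvg, if_neg hr.ne', integral_unif]
  rw [Measure.setIntegral_comp_smul_of_pos volume (fun y => φ (x + y)) _ hr, smul_unitBall hr.ne',
    Real.norm_of_nonneg hr.le]
  have h1 : ∫ y in ball (0 : Euc d) r, φ (x + y) = ∫ y in ball x r, φ y := by
    have := (measurePreserving_add_left (volume : Measure (Euc d)) x).setIntegral_preimage_emb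
      (measurableEmbedding_addLeft x) φ (ball x r)
    rw [← this]
    congr 2
    ext y; simp
  rw [h1, Measure.addHaar_ball_of_pos volume x hr, ENNReal.toReal_mul, 
    ENNReal.toReal_ofReal (by positivity), smul_eq_mul, mul_inv]
  ring

lemma integral_unif_isom (L : Euc d ≃ₗᵢ[ℝ] Euc d) (F : Euc d → ℝ) :
    ∫ u, F (L u) ∂(unif d) = ∫ u, F u ∂(unif d) := by
  rw [integral_unif, integral_unif]
  have := L.measurePreserving.setIntegral_preimage_emb
      L.toMeasurableEquiv.measurableEmbedding F (ball 0 1)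
  rw [← this]
  congr 3
  ext y; simp

lemma moment1 (i : Fin d) : ∫ u, u i ∂(unif d) = 0 := by
  have := integral_unif_isom (LinearIsometryEquiv.neg ℝ) (fun u : Euc d => u i)
  simp only [LinearIsometryEquiv.coe_neg, PiLp.neg_apply, integral_neg] at this
  linarith

lemma moment2_off {i j : Fin d} (hij : i ≠ j) : ∫ u, u i * u j ∂(unif d) = 0 := by
  have := integral_unif_isom (LinearIsometryEquiv.piLpCongrRight 2
    (fun k : Fin d => if k = i then LinearIsometryEquiv.neg ℝ else LinearIsometryEquiv.refl ℝ ℝ))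
    (fun u : Euc d => u i * u j)
  simp [hij.symm, integral_neg] at this
  linarith

lemma moment2_same (i j : Fin d) : ∫ u, u i * u i ∂(unif d) = ∫ u, u j * u j ∂(unif d) := by
  have := integral_unif_isom (LinearIsometryEquiv.piLpCongrLeft 2 ℝ ℝ (Equiv.swap i j))
    (fun u : Euc d => u j * u j)
  simpa [LinearIsometryEquiv.piLpCongrLeft_apply, Equiv.piCongrLeft'] using this

lemma moment_norm (hd : 1 ≤ d) : ∫ u, ‖u‖ ^ 2 ∂(unif d) = d / (d + 2) := by
  have : Nontrivial (Euc d) := by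
    have : Nonempty (Fin d) := ⟨⟨0, hd⟩⟩
    infer_instance
  rw [integral_unif, ← integral_indicator measurableSet_ball]
  have e : (fun u : Euc d => (ball (0 : Euc d) 1).indicator (fun u => ‖u‖ ^ 2) u)
      = fun u => (fun y : ℝ => (Iio (1:ℝ)).indicator (fun y => y ^ 2) y) ‖u‖ := by
    ext u
    simp [indicator]
  rw [e, integral_fun_norm_addHaar volume (fun y : ℝ => (Iio (1:ℝ)).indicator (fun y => y ^ 2) y)]
  have e2 : ∫ y in Ioi (0:ℝ), y ^ (Module.finrank ℝ (Euc d) - 1) • 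
      (Iio (1:ℝ)).indicator (fun y => y ^ 2) y = 1 / (d + 2) := by
    have : (fun y : ℝ => y ^ (Module.finrank ℝ (Euc d) - 1) • 
      (Iio (1:ℝ)).indicator (fun y => y ^ 2) y) = (Iio (1:ℝ)).indicator (fun y => y ^ (d + 1)) := by
      ext y
      by_cases hy : y < 1
      · simp [hy, ← pow_add]
        congr 1; omega
      · simp [hy]
    rw [this, integral_indicator measurableSet_Iio, Measure.restrict_restrict measurableSet_Iio,
      Set.inter_comm, Ioi_inter_Iio, ← integral_Ioc_eq_integral_Ioo,
      ← intervalIntegral.integral_of_le zero_le_one, integral_pow]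
    push_cast
    simp
    ring
  rw [e2]
  have hv : (volume (ball (0 : Euc d) 1)).toReal ≠ 0 := 
    ENNReal.toReal_ne_zero.2 ⟨vol_ball_ne_zero, measure_ball_lt_top.ne⟩
  simp only [finrank_euclideanSpace, Fintype.card_fin, nsmul_eq_mul, smul_eq_mul, Measure.real]
  field_simp

lemma moment2_diag (hd : 1 ≤ d) (i : Fin d) : ∫ u, u i * u i ∂(unif d) = 1 / (d + 2) := by
  have h := moment_norm hd
  have e : (fun u : Euc d => ‖u‖ ^ 2) = fun u => ∑ j, u j * u j := by
    ext u
    rw [EuclideanSpace.norm_sq_eq]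
    simp [sq]
  rw [e, integral_finsetSum _ (fun j _ => integrable_unif (by fun_prop)),
    Finset.sum_congr rfl (fun j _ => moment2_same j i)] at h
  simp only [Finset.sum_const, Finset.card_univ, Fintype.card_fin, nsmul_eq_mul] at h
  have : (0:ℝ) < d := by exact_mod_cast hd
  field_simp at h ⊢
  linarith

lemma moment2 (hd : 1 ≤ d) (i j : Fin d) :
    ∫ u, u i * u j ∂(unif d) = if i = j then 1 / ((d:ℝ) + 2) else 0 := by
  split_ifs with h
  · subst h; exact moment2_diag hd i
  · exact moment2_off h

/-- averaged Taylor remainder -/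
def remd (φ : Euc d → ℝ) (x : Euc d) (r s : ℝ) : ℝ :=
  ∫ z, tay φ x (r • z.1 + s • z.2) ∂((unif d).prod (unif d))

lemma continuous_tay {φ : Euc d → ℝ} (h : ContDiff ℝ 4 φ) :
    Continuous (fun z : Euc d × Euc d => tay φ z.1 z.2) := by
  have hc : Continuous φ := h.continuous
  have hc1 : ∀ i, Continuous (listD [i] φ) := fun i => (contDiff_listD1 h i).continuous
  have hc2 : ∀ i j, Continuous (listD [j, i] φ) := fun i j => (contDiff_listD2 h i j).continuous
  unfold tay
  fun_prop

lemma measurable_remd {φ : Euc d → ℝ} (h : ContDiff ℝ 4 φ) (δ : ℝ) :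
    Measurable (fun z : Euc d × (ℝ × ℝ) => remd φ z.1 (δ * z.2.1) (δ * z.2.2)) := by
  have hc : Continuous (fun y : (Euc d × (ℝ × ℝ)) × (Euc d × Euc d) =>
      tay φ y.1.1 ((δ * y.1.2.1) • y.2.1 + (δ * y.1.2.2) • y.2.2)) :=
    (continuous_tay h).comp (by fun_prop : Continuous
      (fun y : (Euc d × (ℝ × ℝ)) × (Euc d × Euc d) =>
        (y.1.1, (δ * y.1.2.1) • y.2.1 + (δ * y.1.2.2) • y.2.2)))
  exact (hc.measurable.stronglyMeasurable.integral_prod_right'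
    (ν := (unif d).prod (unif d))).measurable

lemma mean1 (r s : ℝ) (i : Fin d) :
    ∫ z : Euc d × Euc d, (r • z.1 + s • z.2) i ∂((unif d).prod (unif d)) = 0 := by
  simp only [PiLp.add_apply, PiLp.smul_apply, smul_eq_mul]
  rw [integral_add (integrable_unif2 (by fun_prop)) (integrable_unif2 (by fun_prop)),
    integral_const_mul, integral_const_mul,
    integral_fun_fst (fun u : Euc d => u i), integral_fun_snd (fun u : Euc d => u i), moment1]
  simp

lemma mean2 (hd : 1 ≤ d) (r s : ℝ) (i j : Fin d) :
    ∫ z : Euc d × Euc d, (r • z.1 + s • z.2) i * (r • z.1 + s • z.2) j ∂((unif d).prod (unif d))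
      = (r ^ 2 + s ^ 2) * (if i = j then 1 / ((d:ℝ) + 2) else 0) := by
  have e : (fun z : Euc d × Euc d => (r • z.1 + s • z.2) i * (r • z.1 + s • z.2) j)
      = fun z => (r ^ 2 * (z.1 i * z.1 j) + s ^ 2 * (z.2 i * z.2 j))
        + (r * s * (z.1 i * z.2 j) + r * s * (z.1 j * z.2 i)) := by
    ext z
    simp only [PiLp.add_apply, PiLp.smul_apply, smul_eq_mul]
    ring
  rw [e, integral_add (integrable_unif2 (by fun_prop)) (integrable_unif2 (by fun_prop)),
    integral_add (integrable_unif2 (by fun_prop)) (integrable_unif2 (by fun_prop)),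
    integral_add (integrable_unif2 (by fun_prop)) (integrable_unif2 (by fun_prop)),
    integral_const_mul, integral_const_mul, integral_const_mul, integral_const_mul,
    integral_fun_fst (fun u : Euc d => u i * u j), integral_fun_snd (fun u : Euc d => u i * u j),
    integral_prod_mul (fun u : Euc d => u i) (fun u : Euc d => u j),
    integral_prod_mul (fun u : Euc d => u j) (fun u : Euc d => u i), moment1, moment1,
    moment2 hd]
  simp
  split_ifs <;> ring

lemma doubleAvg_eq {φ : Euc d → ℝ} (h : Continuous φ) {r s : ℝ} (hr : 0 < r) (hs : 0 < s)
    (x : Euc d) :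
    doubleAvg φ r s x = ∫ z, φ (x + (r • z.1 + s • z.2)) ∂((unif d).prod (unif d)) := by
  rw [integral_prod _ (integrable_unif2 (by fun_prop)), doubleAvg, ballAvg_eq _ hr]
  congr 1
  ext u
  rw [ballAvg_eq _ hs]
  simp [add_assoc]

lemma remd_eq (hd : 1 ≤ d) {φ : Euc d → ℝ} (h : ContDiff ℝ 4 φ) {r s : ℝ} (hr : 0 < r)
    (hs : 0 < s) (x : Euc d) :
    remd φ x r s = doubleAvg φ r s x - φ x - (r ^ 2 + s ^ 2) / (2 * (d + 2)) * lap φ x := by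
  have hc : Continuous φ := h.continuous
  rw [doubleAvg_eq hc hr hs]
  unfold remd tay
  have i1 : Integrable (fun z : Euc d × Euc d => φ (x + (r • z.1 + s • z.2)))
    ((unif d).prod (unif d)) := integrable_unif2 (by fun_prop)
  have i2 : Integrable (fun z : Euc d × Euc d => ∑ i, (r • z.1 + s • z.2) i * listD [i] φ x)
    ((unif d).prod (unif d)) := integrable_unif2 (by fun_prop)
  have i3 : Integrable (fun z : Euc d × Euc d => (1 / 2) * ∑ i, ∑ j, (r • z.1 + s • z.2) i
      * (r • z.1 + s • z.2) j * listD [j, i] φ x)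
    ((unif d).prod (unif d)) := integrable_unif2 (by fun_prop)
  have i1' : Integrable (fun z : Euc d × Euc d => φ (x + (r • z.1 + s • z.2)) - φ x)
    ((unif d).prod (unif d)) := integrable_unif2 (by fun_prop)
  have i12 : Integrable (fun z : Euc d × Euc d => φ (x + (r • z.1 + s • z.2)) - φ x
      - ∑ i, (r • z.1 + s • z.2) i * listD [i] φ x)
    ((unif d).prod (unif d)) := integrable_unif2 (by fun_prop)
  rw [integral_sub i12 i3, integral_sub i1' i2, integral_sub i1 (integrable_const _),
    integral_const_mul,
    integral_finsetSum _ (fun i _ => integrable_unif2 (by fun_prop)),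
    integral_finsetSum _ (fun i _ => integrable_unif2 (by fun_prop))]
  have e1 : ∀ i, ∫ z : Euc d × Euc d, (r • z.1 + s • z.2) i * listD [i] φ x
      ∂((unif d).prod (unif d)) = 0 := fun i => by
    rw [integral_mul_const, mean1, zero_mul]
  have e2 : ∀ i, ∫ z : Euc d × Euc d, ∑ j, (r • z.1 + s • z.2) i
      * (r • z.1 + s • z.2) j * listD [j, i] φ x
      ∂((unif d).prod (unif d)) = (r ^ 2 + s ^ 2) * (1 / ((d:ℝ) + 2)) * listD [i, i] φ x :=
    fun i => by
      rw [integral_finsetSum _ (fun i _ => integrable_unif2 (by fun_prop))]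
      simp only [integral_mul_const, mean2 hd]
      simp
  simp only [e1, e2, Finset.sum_const_zero, sub_zero, integral_const, probReal_univ, one_smul]
  rw [← Finset.mul_sum, lap]
  congr 1
  field_simp

lemma eLpNorm_remd {φ : Euc d → ℝ} (h : ContDiff ℝ 4 φ) (p : ℝ≥0∞) (hp : 1 ≤ p)
    (θ : ℝ) (hθ0 : 0 < θ) (hθ1 : θ ≤ 1) {r s : ℝ} (hr : 0 < r) (hs : 0 < s) :
    eLpNorm (fun x => remd φ x r s) p volume
      ≤ ENNReal.ofReal (2 * d ^ 3 * ((r + s) ^ 2 * (r + s) ^ θ)) * maxDle 4 φ p := by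
  have hc : Continuous (fun y : Euc d × (Euc d × Euc d) =>
      tay φ y.1 (r • y.2.1 + s • y.2.2)) :=
    (continuous_tay h).comp (by fun_prop : Continuous
      (fun y : Euc d × (Euc d × Euc d) => (y.1, r • y.2.1 + s • y.2.2)))
  have hm := mink_unif (volume : Measure (Euc d)) ((unif d).prod (unif d)) p hp
    (fun y => ‖tay φ y.1 (r • y.2.1 + s • y.2.2)‖ₑ) hc.measurable.enorm
    (ENNReal.ofReal (2 * d ^ 3 * ((r + s) ^ 2 * (r + s) ^ θ)) * maxDle 4 φ p) (by
      filter_upwards [unif2_ae] with z hz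
      simp only [eLpNorm_enorm]
      refine (eLpNorm_tay h p hp _ θ hθ0 hθ1).trans ?_
      have hv : ‖r • z.1 + s • z.2‖ ≤ r + s := by
        refine (norm_add_le _ _).trans ?_
        rw [norm_smul, norm_smul, Real.norm_of_nonneg hr.le, Real.norm_of_nonneg hs.le]
        have h1 : ‖z.1‖ ≤ 1 := by simpa using hz.1
        have h2 : ‖z.2‖ ≤ 1 := by simpa using hz.2
        nlinarith
      gcongr)
  simp only [measure_univ, one_mul] at hm
  refine le_trans (eLpNorm_mono_enorm fun x => ?_) hm
  simpa [remd] using enorm_integral_le_lintegral_enorm _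

lemma ae_finite_of_eLpNorm {E : Type*} [MeasurableSpace E] (ν : Measure E) (p : ℝ≥0∞)
    (hp : 1 ≤ p) (f : E → ℝ≥0∞) (hf : Measurable f) (h : eLpNorm f p ν < ∞) :
    ∀ᵐ x ∂ν, f x < ∞ := by
  rcases eq_or_ne p ∞ with rfl | hpt
  · rw [eLpNorm_exponent_top] at h
    filter_upwards [ae_le_eLpNormEssSup (f := f) (μ := ν)] with x hx
    exact lt_of_le_of_lt (by simpa using hx) h
  · have hp0 : p ≠ 0 := (zero_lt_one.trans_le hp).ne'
    have h2 := lintegral_rpow_enorm_lt_top_of_eLpNorm_lt_top hp0 hpt h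
    have h3 := ae_lt_top (by fun_prop) h2.ne
    filter_upwards [h3] with x hx
    exact (ENNReal.rpow_lt_top_iff_of_pos (ENNReal.toReal_pos hp0 hpt)).1 (by simpa using hx)

/-- the measure on pairs of radii -/
def radm : Measure (ℝ × ℝ) := (volume.restrict (Ioi 1)).prod (volume.restrict (Ioi 1))

instance : SFinite radm := by unfold radm; infer_instance

lemma radm_ae : ∀ᵐ ω ∂radm, 1 < ω.1 ∧ 1 < ω.2 := by
  have h : ∀ᵐ t ∂((volume : Measure ℝ).restrict (Ioi 1)), 1 < t :=
    ae_restrict_mem measurableSet_Ioi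
  have h1 := (Measure.quasiMeasurePreserving_fst (μ := (volume : Measure ℝ).restrict (Ioi 1))
    (ν := (volume : Measure ℝ).restrict (Ioi 1))).ae h
  have h2 := (Measure.quasiMeasurePreserving_snd (μ := (volume : Measure ℝ).restrict (Ioi 1))
    (ν := (volume : Measure ℝ).restrict (Ioi 1))).ae h
  filter_upwards [h1, h2] with z hz1 hz2
  exact ⟨hz1, hz2⟩

lemma radm_integrable {b c : ℝ} (hb : b < -1) (hc : c < -1) :
    Integrable (fun ω : ℝ × ℝ => ω.1 ^ b * ω.2 ^ c) radm :=
  (integrableOn_Ioi_rpow_of_lt hb zero_lt_one).mul_prod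
    (integrableOn_Ioi_rpow_of_lt hc zero_lt_one)

lemma radm_integral {b c : ℝ} (hb : b < -1) (hc : c < -1) :
    ∫ ω : ℝ × ℝ, ω.1 ^ b * ω.2 ^ c ∂radm = 1 / (b + 1) * (1 / (c + 1)) := by
  unfold radm
  rw [integral_prod_mul (fun t : ℝ => t ^ b) (fun t : ℝ => t ^ c),
    integral_Ioi_rpow_of_lt hb zero_lt_one, integral_Ioi_rpow_of_lt hc zero_lt_one]
  simp
  ring

lemma radm_lintegral {b c K : ℝ} (hK : 0 ≤ K) (hb : b < -1) (hc : c < -1) :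
    ∫⁻ ω : ℝ × ℝ, ENNReal.ofReal (K * (ω.1 ^ b * ω.2 ^ c)) ∂radm
      = ENNReal.ofReal (K * (1 / (b + 1) * (1 / (c + 1)))) := by
  rw [← ofReal_integral_eq_lintegral_ofReal ((radm_integrable hb hc).const_mul K),
    integral_const_mul, radm_integral hb hc]
  filter_upwards [radm_ae] with ω hω
  have h1 : 0 < ω.1 := by linarith [hω.1]
  have h2 : 0 < ω.2 := by linarith [hω.2]
  simp only [Pi.zero_apply]
  positivity

lemma weight_bound {δ x y θ a b D : ℝ} (hδ : 0 < δ) (hx : 1 < x) (hy : 1 < y) (hθ0 : 0 < θ)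
    (hθ1 : θ ≤ 1) (hD : 0 ≤ D) :
    (x ^ (1 + a) * y ^ (1 + b))⁻¹ * (2 * D * ((δ * x + δ * y) ^ 2 * (δ * x + δ * y) ^ θ))
      ≤ 16 * D * δ ^ (2 + θ) * (x ^ (1 + θ - a) * y ^ (1 + θ - b)) := by
  have hx0 : 0 < x := by linarith
  have hy0 : 0 < y := by linarith
  have hs : 0 < δ * x + δ * y := by positivity
  have h1 : (δ * x + δ * y) ^ 2 * (δ * x + δ * y) ^ θ = (δ * x + δ * y) ^ (2 + θ) := by
    rw [Real.rpow_add hs, Real.rpow_two]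
  have h2 : (δ * x + δ * y) ^ (2 + θ) ≤ (2 * (δ * (x * y))) ^ (2 + θ) := by
    apply Real.rpow_le_rpow hs.le _ (by linarith)
    have : x + y ≤ 2 * (x * y) := by nlinarith
    nlinarith
  have h3 : (2 * (δ * (x * y))) ^ (2 + θ)
      = 2 ^ (2 + θ) * (δ ^ (2 + θ) * (x ^ (2 + θ) * y ^ (2 + θ))) := by
    rw [Real.mul_rpow (by positivity) (by positivity),
      Real.mul_rpow (by positivity) (by positivity), Real.mul_rpow (by positivity) (by positivity)]
  have h4 : (2:ℝ) ^ (2 + θ) ≤ 8 := by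
    calc (2:ℝ) ^ (2 + θ) ≤ (2:ℝ) ^ (3:ℝ) :=
          Real.rpow_le_rpow_of_exponent_le (by norm_num) (by linarith)
      _ = 8 := by norm_num
  have h5 : x ^ (1 + θ - a) = (x ^ (1 + a))⁻¹ * x ^ (2 + θ) := by
    rw [← Real.rpow_neg hx0.le, ← Real.rpow_add hx0]; congr 1; ring
  have h6 : y ^ (1 + θ - b) = (y ^ (1 + b))⁻¹ * y ^ (2 + θ) := by
    rw [← Real.rpow_neg hy0.le, ← Real.rpow_add hy0]; congr 1; ring
  calc _ ≤ (x ^ (1 + a) * y ^ (1 + b))⁻¹ * (2 * D *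
        (8 * (δ ^ (2 + θ) * (x ^ (2 + θ) * y ^ (2 + θ))))) := by
        rw [h1]
        gcongr
        exact h2.trans (h3.le.trans (by gcongr))
    _ = _ := by
        rw [h5, h6, mul_inv]; ring

lemma quad_eq {x y a b : ℝ} (hx : 0 < x) (hy : 0 < y) :
    (x ^ 2 + y ^ 2) / (x ^ (1 + a) * y ^ (1 + b))
      = x ^ (1 - a) * y ^ (-1 - b) + x ^ (-1 - a) * y ^ (1 - b) := by
  have e1 : x ^ (1 - a) = x ^ 2 * (x ^ (1 + a))⁻¹ := by
    rw [← Real.rpow_neg hx.le, ← Real.rpow_two, ← Real.rpow_add hx]; congr 1; ring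
  have e2 : y ^ (1 - b) = y ^ 2 * (y ^ (1 + b))⁻¹ := by
    rw [← Real.rpow_neg hy.le, ← Real.rpow_two, ← Real.rpow_add hy]; congr 1; ring
  have e3 : x ^ (-1 - a) = (x ^ (1 + a))⁻¹ := by
    rw [← Real.rpow_neg hx.le]; congr 1; ring
  have e4 : y ^ (-1 - b) = (y ^ (1 + b))⁻¹ := by
    rw [← Real.rpow_neg hy.le]; congr 1; ring
  rw [e1, e2, e3, e4, div_eq_mul_inv, mul_inv]
  ring

/-- pointwise identity, when the remainder is integrable -/
lemma pointwise_eq (hd : 1 ≤ d) {φ : Euc d → ℝ} (h : ContDiff ℝ 4 φ) {a₁ a₂ δ : ℝ}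
    (ha₁ : 2 < a₁) (ha₂ : 2 < a₂) (hδ : 0 < δ) (c : ℝ) (x : Euc d)
    (hI : Integrable (fun ω : ℝ × ℝ => (ω.1 ^ (1 + a₁) * ω.2 ^ (1 + a₂))⁻¹ *
      remd φ x (δ * ω.1) (δ * ω.2)) radm) :
    (c * δ ^ (-2 : ℝ) *
        ∫ r₁ in Set.Ioi (1 : ℝ), ∫ r₂ in Set.Ioi (1 : ℝ),
          (doubleAvg φ (δ * r₁) (δ * r₂) x - φ x) / (r₁ ^ (1 + a₁) * r₂ ^ (1 + a₂)))
      - c / ((d : ℝ) + 2) *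
          (1 / ((a₁ - 2) * a₂) + 1 / (a₁ * (a₂ - 2))) / 2 * lap φ x
      = c * δ ^ (-2 : ℝ) * ∫ ω : ℝ × ℝ, (ω.1 ^ (1 + a₁) * ω.2 ^ (1 + a₂))⁻¹ *
          remd φ x (δ * ω.1) (δ * ω.2) ∂radm := by
  set κ : ℝ := δ ^ 2 / (2 * (d + 2)) * lap φ x with hκ
  have q1 := radm_integrable (b := 1 - a₁) (c := -1 - a₂) (by linarith) (by linarith)
  have q2 := radm_integrable (b := -1 - a₁) (c := 1 - a₂) (by linarith) (by linarith)
  have hae : (fun ω : ℝ × ℝ => (doubleAvg φ (δ * ω.1) (δ * ω.2) x - φ x) /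
        (ω.1 ^ (1 + a₁) * ω.2 ^ (1 + a₂)))
      =ᵐ[radm] fun ω => (ω.1 ^ (1 + a₁) * ω.2 ^ (1 + a₂))⁻¹ * remd φ x (δ * ω.1) (δ * ω.2)
        + κ * (ω.1 ^ (1 - a₁) * ω.2 ^ (-1 - a₂) + ω.1 ^ (-1 - a₁) * ω.2 ^ (1 - a₂)) := by
    filter_upwards [radm_ae] with ω hω
    have h1 : 0 < ω.1 := by linarith [hω.1]
    have h2 : 0 < ω.2 := by linarith [hω.2]
    rw [remd_eq hd h (by positivity) (by positivity), ← quad_eq h1 h2, hκ]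
    have p1 : 0 < ω.1 ^ (1 + a₁) := by positivity
    have p2 : 0 < ω.2 ^ (1 + a₂) := by positivity
    field_simp
    ring
  have q12 : Integrable (fun ω : ℝ × ℝ => κ * (ω.1 ^ (1 - a₁) * ω.2 ^ (-1 - a₂)
      + ω.1 ^ (-1 - a₁) * ω.2 ^ (1 - a₂))) radm := (q1.add q2).const_mul κ
  have hI2 := hI.add ((q1.add q2).const_mul κ)
  have hI3 : Integrable (fun ω : ℝ × ℝ => (doubleAvg φ (δ * ω.1) (δ * ω.2) x - φ x) /
        (ω.1 ^ (1 + a₁) * ω.2 ^ (1 + a₂))) radm := hI2.congr hae.symm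
  have e := integral_prod _ hI3
  simp only at e
  rw [← e]
  change c * δ ^ (-2 : ℝ) * (∫ ω : ℝ × ℝ, (doubleAvg φ (δ * ω.1) (δ * ω.2) x - φ x) /
        (ω.1 ^ (1 + a₁) * ω.2 ^ (1 + a₂)) ∂radm) - _ = _
  rw [integral_congr_ae hae, integral_add hI q12, integral_const_mul,
    integral_add q1 q2, radm_integral (by linarith) (by linarith),
    radm_integral (by linarith) (by linarith), hκ]
  have n1 : a₁ - 2 ≠ 0 := by linarith
  have n2 : a₂ - 2 ≠ 0 := by linarith
  have n3 : a₁ ≠ 0 := by linarith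
  have n4 : a₂ ≠ 0 := by linarith
  have hδ2 : δ ^ (-2 : ℝ) * δ ^ 2 = 1 := by
    rw [← Real.rpow_two, ← Real.rpow_add hδ]; simp
  have f1 : 1 / (1 - a₁ + 1) * (1 / (-1 - a₂ + 1)) = 1 / ((a₁ - 2) * a₂) := by
    rw [show 1 - a₁ + 1 = -(a₁ - 2) by ring, show -1 - a₂ + 1 = -a₂ by ring]
    field_simp
  have f2 : 1 / (-1 - a₁ + 1) * (1 / (1 - a₂ + 1)) = 1 / (a₁ * (a₂ - 2)) := by
    rw [show 1 - a₂ + 1 = -(a₂ - 2) by ring, show -1 - a₁ + 1 = -a₁ by ring]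
    field_simp
  rw [f1, f2]
  generalize 1 / ((a₁ - 2) * a₂) + 1 / (a₁ * (a₂ - 2)) = S
  generalize (∫ ω : ℝ × ℝ, (ω.1 ^ (1 + a₁) * ω.2 ^ (1 + a₂))⁻¹ *
          remd φ x (δ * ω.1) (δ * ω.2) ∂radm) = I
  have : c * δ ^ (-2 : ℝ) * (I + δ ^ 2 / (2 * (d + 2)) * lap φ x * S)
      = c * δ ^ (-2 : ℝ) * I + (δ ^ (-2 : ℝ) * δ ^ 2) * (c / (d + 2) * S / 2 * lap φ x) := by
    have : (d:ℝ) + 2 ≠ 0 := by positivity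
    field_simp
  rw [this, hδ2]
  ring

end Helpers

/-- two-tails regime, Brownian case: with `a₁ > 2`, `a₂ > 2`,
`L^δ φ(x) = u₀ V₁ δ^{−2} ∫₁^∞ ∫₁^∞ (φ̄̄(x, δ r₁, δ r₂) − φ(x)) dr₁ dr₂/(r₁^{1+a₁} r₂^{1+a₂})`
and `σ² = (u₀V₁/(d+2))(1/((a₁−2)a₂) + 1/(a₁(a₂−2)))`, there exist `C > 0`, `θ > 0` such
that for all `δ ∈ (0,1)` and all admissible `φ`,
`‖L^δ φ − (σ²/2) Δφ‖_p ≤ C δ^θ max_{|κ|≤4} ‖∂_κ φ‖_p`. -/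
theorem stmt19 (d : ℕ) (hd : 1 ≤ d) (u₀ : ℝ) (hu : 0 < u₀) (p : ℝ≥0∞) (hp : 1 ≤ p)
    (a₁ a₂ : ℝ) (ha₁ : 2 < a₁) (ha₂ : 2 < a₂) :
    ∃ C : ℝ, 0 < C ∧ ∃ θ : ℝ, 0 < θ ∧
      ∀ δ : ℝ, 0 < δ → δ < 1 →
        ∀ φ : Euc d → ℝ, ContDiff ℝ 4 φ → maxDle 4 φ p < ⊤ →
          eLpNorm (fun x =>
              (u₀ * V1 d * δ ^ (-2 : ℝ) *
                ∫ r₁ in Set.Ioi (1 : ℝ), ∫ r₂ in Set.Ioi (1 : ℝ),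
                  (doubleAvg φ (δ * r₁) (δ * r₂) x - φ x) / (r₁ ^ (1 + a₁) * r₂ ^ (1 + a₂)))
              - u₀ * V1 d / ((d : ℝ) + 2) *
                  (1 / ((a₁ - 2) * a₂) + 1 / (a₁ * (a₂ - 2))) / 2 * lap φ x) p volume
          ≤ ENNReal.ofReal (C * δ ^ θ) * maxDle 4 φ p := by
  set θ : ℝ := min 1 (min (a₁ - 2) (a₂ - 2) / 2) with hθ
  have hmin : 0 < min (a₁ - 2) (a₂ - 2) := lt_min (by linarith) (by linarith)
  have hθ0 : 0 < θ := lt_min one_pos (by linarith)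
  have hθ1 : θ ≤ 1 := min_le_left _ _
  have hθm : θ ≤ min (a₁ - 2) (a₂ - 2) / 2 := min_le_right _ _
  have hθa : θ < a₁ - 2 := by linarith [min_le_left (a₁ - 2) (a₂ - 2)]
  have hθb : θ < a₂ - 2 := by linarith [min_le_right (a₁ - 2) (a₂ - 2)]
  have hV : 0 < V1 d := ENNReal.toReal_pos vol_ball_ne_zero measure_ball_lt_top.ne
  have hd0 : (0:ℝ) < d := by exact_mod_cast hd
  set W : ℝ := 1 / (1 + θ - a₁ + 1) * (1 / (1 + θ - a₂ + 1)) with hW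
  have hW0 : 0 < W := by
    rw [hW, show 1 + θ - a₁ + 1 = -(a₁ - 2 - θ) by ring,
      show 1 + θ - a₂ + 1 = -(a₂ - 2 - θ) by ring, one_div_neg_eq_neg_one_div,
      one_div_neg_eq_neg_one_div, neg_mul_neg]
    have : 0 < a₁ - 2 - θ := by linarith
    have : 0 < a₂ - 2 - θ := by linarith
    positivity
  refine ⟨u₀ * V1 d * (16 * d ^ 3 * W), by positivity, θ, hθ0, ?_⟩
  intro δ hδ0 hδ1 φ h hfin
  set F : Euc d × (ℝ × ℝ) → ℝ := fun z => (z.2.1 ^ (1 + a₁) * z.2.2 ^ (1 + a₂))⁻¹ *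
      remd φ z.1 (δ * z.2.1) (δ * z.2.2) with hF
  have hFm : Measurable F := by
    refine Measurable.mul ?_ (measurable_remd h δ)
    fun_prop
  set K : ℝ := 16 * d ^ 3 * δ ^ (2 + θ) with hK
  have hK0 : 0 < K := by positivity
  have hlint := radm_lintegral (b := 1 + θ - a₁) (c := 1 + θ - a₂) hK0.le (by linarith)
    (by linarith)
  have hbd : ∀ᵐ ω ∂radm, eLpNorm (fun x => ‖F (x, ω)‖ₑ) p volume
      ≤ ENNReal.ofReal (K * (ω.1 ^ (1 + θ - a₁) * ω.2 ^ (1 + θ - a₂))) * maxDle 4 φ p := by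
    filter_upwards [radm_ae] with ω hω
    have h1 : 0 < ω.1 := by linarith [hω.1]
    have h2 : 0 < ω.2 := by linarith [hω.2]
    have hs := eLpNorm_const_smul ((ω.1 ^ (1 + a₁) * ω.2 ^ (1 + a₂))⁻¹)
      (fun x => remd φ x (δ * ω.1) (δ * ω.2)) p (volume : Measure (Euc d))
    have hs2 : eLpNorm (fun x => F (x, ω)) p volume = _ := hs
    rw [eLpNorm_enorm (fun x => F (x, ω)), hs2]
    have hr := eLpNorm_remd h p hp θ hθ0 hθ1 (r := δ * ω.1) (s := δ * ω.2) (by positivity)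
      (by positivity)
    refine (mul_le_mul_right hr _).trans ?_
    rw [← mul_assoc, Real.enorm_eq_ofReal (by positivity),
      ← ENNReal.ofReal_mul (by positivity)]
    gcongr ENNReal.ofReal ?_ * _
    exact weight_bound hδ0 hω.1 hω.2 hθ0 hθ1 (by positivity)
  have hmink := mink_weight (volume : Measure (Euc d)) radm p hp (fun z => ‖F z‖ₑ) hFm.enorm
    (maxDle 4 φ p) (fun ω => ENNReal.ofReal (K * (ω.1 ^ (1 + θ - a₁) * ω.2 ^ (1 + θ - a₂))))
    (by fun_prop)
    (by
      filter_upwards [radm_ae] with ω hω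
      have h1 : 0 < ω.1 := by linarith [hω.1]
      have h2 : 0 < ω.2 := by linarith [hω.2]
      have : 0 < K * (ω.1 ^ (1 + θ - a₁) * ω.2 ^ (1 + θ - a₂)) := by positivity
      simpa using this)
    (by rw [hlint]; exact ENNReal.ofReal_ne_top)
    hbd
  rw [hlint] at hmink
  have hfin2 := ae_finite_of_eLpNorm (volume : Measure (Euc d)) p hp
    (fun x => ∫⁻ ω, ‖F (x, ω)‖ₑ ∂radm) (hFm.enorm.lintegral_prod_right')
    (hmink.trans_lt (ENNReal.mul_lt_top ENNReal.ofReal_lt_top hfin))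
  have hcong : (fun x =>
              (u₀ * V1 d * δ ^ (-2 : ℝ) *
                ∫ r₁ in Set.Ioi (1 : ℝ), ∫ r₂ in Set.Ioi (1 : ℝ),
                  (doubleAvg φ (δ * r₁) (δ * r₂) x - φ x) / (r₁ ^ (1 + a₁) * r₂ ^ (1 + a₂)))
              - u₀ * V1 d / ((d : ℝ) + 2) *
                  (1 / ((a₁ - 2) * a₂) + 1 / (a₁ * (a₂ - 2))) / 2 * lap φ x)
      =ᵐ[volume] (u₀ * V1 d * δ ^ (-2 : ℝ)) • fun x => ∫ ω, F (x, ω) ∂radm := by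
    filter_upwards [hfin2] with x hx
    exact pointwise_eq hd h ha₁ ha₂ hδ0 (u₀ * V1 d) x
      ⟨(hFm.comp measurable_prodMk_left).aestronglyMeasurable, hx⟩
  rw [eLpNorm_congr_ae hcong, eLpNorm_const_smul]
  have hle : eLpNorm (fun x => ∫ ω, F (x, ω) ∂radm) p volume
      ≤ eLpNorm (fun x => ∫⁻ ω, ‖F (x, ω)‖ₑ ∂radm) p volume :=
    eLpNorm_mono_enorm fun x => by simpa using enorm_integral_le_lintegral_enorm _
  calc _ ≤ ‖u₀ * V1 d * δ ^ (-2 : ℝ)‖ₑ * (ENNReal.ofReal (K * W) * maxDle 4 φ p) := by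
        gcongr
        exact hle.trans hmink
    _ = _ := by
        rw [← mul_assoc, Real.enorm_eq_ofReal (by positivity),
          ← ENNReal.ofReal_mul (by positivity)]
        congr 2
        have hδ2 : δ ^ (-2 : ℝ) * δ ^ (2 + θ) = δ ^ θ := by
          rw [← Real.rpow_add hδ0]; congr 1; ring
        rw [hK, ← hδ2]
        ring

end
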